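/- arXiv:2509.18873 — 8 statements merged into one kernel-verified Lean document; each statement's English description precedes it below -/
import Mathlib

section
/- Suppose B ≥ 1, a_0 = 1, a_n ≠ 0 for all n ≥ 1, and |a_n| ≤ B, |b_n| ≤ B for all n ≥ 1. Let z ∈ ℂ with 0 < |z| < 1/(3B+1) and set λ = z + 1/z. Then H - λI is invertible in the Banach algebra of continuous linear operators on ℓ²(ℕ,ℂ), the series Σ_{t=0}^∞ z^t u^δ(1,t) converges absolutely, and the first coordinate of (H - λI)⁻¹ e₁ equals -Σ_{t=0}^∞ z^t u^δ(1,t). -/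
/-- The control δ: δ(0)=1, δ(t)=0 for t ≥ 1. -/
noncomputable def deltaCtrl : ℕ → ℂ := fun t => if t = 0 then 1 else 0

/-- `IsSol a b f u` : `u` is the solution of the semi-infinite discrete dynamical
system with coefficients `a`, `b` and boundary control `f`. -/
def IsSol (a b : ℕ → ℂ) (f : ℕ → ℂ) (u : ℕ → ℤ → ℂ) : Prop :=
  (∀ n : ℕ, 1 ≤ n → ∀ t : ℤ, t ≤ 0 → u n t = 0) ∧
  (∀ t : ℕ, u 0 (t : ℤ) = f t) ∧
  (∀ t : ℤ, t < 0 → u 0 t = 0) ∧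
  (∀ n : ℕ, 1 ≤ n → ∀ t : ℕ,
    u n ((t : ℤ) + 1) + u n ((t : ℤ) - 1) - a n * u (n + 1) (t : ℤ)
      - a (n - 1) * u (n - 1) (t : ℤ) - b n * u n (t : ℤ) = 0)

/-- The Chebyshev-type orbit `x₀ = 0`, `x₁ = e`, `xₜ₊₂ = T xₜ₊₁ - xₜ`. -/
def chebyshevOrbit {E : Type*} [NormedAddCommGroup E] [NormedSpace ℂ E]
    (T : E →L[ℂ] E) (e : E) : ℕ → E
  | 0 => 0
  | 1 => e
  | t + 2 => T (chebyshevOrbit T e (t + 1)) - chebyshevOrbit T e t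

section ChebyshevOrbit

variable {E : Type*} [NormedAddCommGroup E] [NormedSpace ℂ E] {T : E →L[ℂ] E} {M : ℝ}

theorem norm_chebyshevOrbit_le (hM : ‖T‖ ≤ M) (e : E) (t : ℕ) :
    ‖chebyshevOrbit T e t‖ ≤ ‖e‖ * (M + 1) ^ t := by
  have hM0 : 0 ≤ M := (norm_nonneg T).trans hM
  induction t using Nat.twoStepInduction with
  | zero => simp [chebyshevOrbit]
  | one =>
    simp only [chebyshevOrbit, pow_one]
    nlinarith [norm_nonneg e]
  | more t ih₀ ih₁ =>
    have hT : ‖T (chebyshevOrbit T e (t + 1))‖ ≤ M * (‖e‖ * (M + 1) ^ (t + 1)) :=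
      (T.le_of_opNorm_le hM _).trans (mul_le_mul_of_nonneg_left ih₁ hM0)
    have hpow : 0 ≤ M * (‖e‖ * (M + 1) ^ t) := by positivity
    calc ‖chebyshevOrbit T e (t + 2)‖
        ≤ ‖T (chebyshevOrbit T e (t + 1))‖ + ‖chebyshevOrbit T e t‖ := norm_sub_le _ _
      _ ≤ M * (‖e‖ * (M + 1) ^ (t + 1)) + ‖e‖ * (M + 1) ^ t := add_le_add hT ih₀
      _ ≤ ‖e‖ * (M + 1) ^ (t + 2) := by
        rw [pow_succ _ (t + 1), pow_succ _ t]
        linarith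

theorem summable_norm_smul_chebyshevOrbit (hM : ‖T‖ ≤ M) (e : E) {z : ℂ}
    (hz : ‖z‖ * (M + 1) < 1) : Summable fun t : ℕ => ‖z ^ t • chebyshevOrbit T e t‖ := by
  have hM0 : 0 ≤ M := (norm_nonneg T).trans hM
  refine Summable.of_nonneg_of_le (fun _ => norm_nonneg _) (fun t => ?_)
    ((summable_geometric_of_lt_one (by positivity) hz).mul_left ‖e‖)
  rw [norm_smul, norm_pow, mul_pow, mul_left_comm]
  gcongr
  exact norm_chebyshevOrbit_le hM e t

/-- The generating series of the orbit inverts `T - (z + 1/z)` at `-e`. -/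
theorem sub_smul_one_apply_tsum_chebyshevOrbit {e : E} {z : ℂ} (hz : z ≠ 0)
    (hs : Summable fun t : ℕ => z ^ t • chebyshevOrbit T e t) :
    (T - (z + 1 / z) • (1 : E →L[ℂ] E)) (∑' t : ℕ, z ^ t • chebyshevOrbit T e t) = -e := by
  set G := ∑' t : ℕ, z ^ t • chebyshevOrbit T e t with hG
  have hs₁ := (summable_nat_add_iff 1).2 hs
  have hG₁ : G = ∑' t : ℕ, z ^ (t + 1) • chebyshevOrbit T e (t + 1) := by
    rw [hG, hs.tsum_eq_zero_add]
    simp [chebyshevOrbit]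
  have hTG : T G = ∑' t : ℕ, T (z ^ (t + 1) • chebyshevOrbit T e (t + 1)) := by
    rw [hG₁, T.map_tsum hs₁]
  have hrec : G = z • e + (z • T G - z ^ 2 • G) := by
    conv_lhs => rw [hG₁, hs₁.tsum_eq_zero_add]
    rw [hTG, hG, ← (T.summable hs₁).tsum_const_smul z, ← hs.tsum_const_smul (z ^ 2),
      ← ((T.summable hs₁).const_smul z).tsum_sub (hs.const_smul (z ^ 2))]
    congr 1
    · simp [chebyshevOrbit]
    · refine tsum_congr fun t => ?_
      rw [chebyshevOrbit, map_smul, smul_smul, smul_smul, smul_sub]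
      congr 2 <;> ring
  have hzero : z • (T G - (z + 1 / z) • G + e) = 0 := by
    have hcoef : z * (z + 1 / z) = z ^ 2 + 1 := by field_simp
    rw [smul_add, smul_sub, smul_smul, hcoef, add_smul, one_smul]
    nth_rewrite 3 [hrec]
    abel
  have := (smul_eq_zero.1 hzero).resolve_left hz
  simpa using eq_neg_of_add_eq_zero_left this

end ChebyshevOrbit

theorem lp_two_hasSum_norm_sq (ψ : lp (fun _ : ℕ => ℂ) 2) :
    HasSum (fun k => ‖(ψ : ℕ → ℂ) k‖ ^ 2) (‖ψ‖ ^ 2) := by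
  simpa using lp.hasSum_norm (p := 2) (by norm_num) ψ

theorem norm_three_term_sq_le {B : ℝ} {α β γ : ℂ} (hα : ‖α‖ ≤ B) (hβ : ‖β‖ ≤ B)
    (hγ : ‖γ‖ ≤ B) (x y w : ℂ) :
    ‖α * x + β * y + γ * w‖ ^ 2 ≤ 3 * B ^ 2 * (‖x‖ ^ 2 + ‖y‖ ^ 2 + ‖w‖ ^ 2) := by
  have hB : 0 ≤ B := (norm_nonneg _).trans hα
  have h : ‖α * x + β * y + γ * w‖ ≤ B * (‖x‖ + ‖y‖ + ‖w‖) :=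
    calc ‖α * x + β * y + γ * w‖ ≤ ‖α * x‖ + ‖β * y‖ + ‖γ * w‖ := norm_add₃_le
      _ ≤ B * ‖x‖ + B * ‖y‖ + B * ‖w‖ := by
        simp only [norm_mul]
        gcongr
      _ = B * (‖x‖ + ‖y‖ + ‖w‖) := by ring
  calc ‖α * x + β * y + γ * w‖ ^ 2 ≤ (B * (‖x‖ + ‖y‖ + ‖w‖)) ^ 2 := by gcongr
    _ = B ^ 2 * (‖x‖ + ‖y‖ + ‖w‖) ^ 2 := by ring
    _ ≤ B ^ 2 * (3 * (‖x‖ ^ 2 + ‖y‖ ^ 2 + ‖w‖ ^ 2)) := by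
      gcongr
      nlinarith [sq_nonneg (‖x‖ - ‖y‖), sq_nonneg (‖y‖ - ‖w‖), sq_nonneg (‖x‖ - ‖w‖)]
    _ = 3 * B ^ 2 * (‖x‖ ^ 2 + ‖y‖ ^ 2 + ‖w‖ ^ 2) := by ring

section Jacobi

variable {a b : ℕ → ℂ} {H : lp (fun _ : ℕ => ℂ) 2 →L[ℂ] lp (fun _ : ℕ => ℂ) 2}

theorem jacobi_opNorm_le {B : ℝ}
    (haB : ∀ n : ℕ, 1 ≤ n → ‖a n‖ ≤ B) (hbB : ∀ n : ℕ, 1 ≤ n → ‖b n‖ ≤ B)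
    (hH1 : ∀ ψ : lp (fun _ : ℕ => ℂ) 2,
      (H ψ : ℕ → ℂ) 0 = b 1 * (ψ : ℕ → ℂ) 0 + a 1 * (ψ : ℕ → ℂ) 1)
    (hH2 : ∀ ψ : lp (fun _ : ℕ => ℂ) 2, ∀ k : ℕ, 1 ≤ k →
      (H ψ : ℕ → ℂ) k = a k * (ψ : ℕ → ℂ) (k - 1) + b (k + 1) * (ψ : ℕ → ℂ) k
        + a (k + 1) * (ψ : ℕ → ℂ) (k + 1)) :
    ‖H‖ ≤ 3 * B := by
  have hB : 0 ≤ B := (norm_nonneg _).trans (haB 1 le_rfl)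
  refine H.opNorm_le_bound (by positivity) fun ψ => ?_
  refine (sq_le_sq₀ (norm_nonneg _) (by positivity)).1 ?_
  have hq := lp_two_hasSum_norm_sq ψ
  have hq₁ := (hasSum_nat_add_iff' 1).2 hq
  have hq₂ := (hasSum_nat_add_iff' 2).2 hq
  have hH := (hasSum_nat_add_iff' 1).2 (lp_two_hasSum_norm_sq (H ψ))
  have htail := hasSum_le (fun k => ?_) hH (((hq.add hq₁).add hq₂).mul_left (3 * B ^ 2))
  · have hhead : ‖(H ψ : ℕ → ℂ) 0‖ ^ 2 ≤
        3 * B ^ 2 * (‖(ψ : ℕ → ℂ) 0‖ ^ 2 + ‖(ψ : ℕ → ℂ) 1‖ ^ 2) := by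
      rw [hH1]
      simpa using norm_three_term_sq_le (hbB 1 le_rfl) (haB 1 le_rfl)
        (haB 1 le_rfl) ((ψ : ℕ → ℂ) 0) ((ψ : ℕ → ℂ) 1) 0
    simp only [Finset.sum_range_succ, Finset.sum_range_zero, zero_add] at htail
    have hnonneg : 0 ≤ B ^ 2 * ‖(ψ : ℕ → ℂ) 0‖ ^ 2 := by positivity
    linarith
  · rw [hH2 ψ (k + 1) (by omega)]
    exact norm_three_term_sq_le (haB _ (by omega)) (hbB _ (by omega)) (haB _ (by omega)) _ _ _

theorem IsSol.eq_chebyshevOrbit {u : ℕ → ℤ → ℂ} (ha0 : a 0 = 1)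
    (hH1 : ∀ ψ : lp (fun _ : ℕ => ℂ) 2,
      (H ψ : ℕ → ℂ) 0 = b 1 * (ψ : ℕ → ℂ) 0 + a 1 * (ψ : ℕ → ℂ) 1)
    (hH2 : ∀ ψ : lp (fun _ : ℕ => ℂ) 2, ∀ k : ℕ, 1 ≤ k →
      (H ψ : ℕ → ℂ) k = a k * (ψ : ℕ → ℂ) (k - 1) + b (k + 1) * (ψ : ℕ → ℂ) k
        + a (k + 1) * (ψ : ℕ → ℂ) (k + 1))
    (hu : IsSol a b deltaCtrl u) (t k : ℕ) :
    u (k + 1) (t : ℤ) = ((chebyshevOrbit H (lp.single 2 (0 : ℕ) (1 : ℂ)) t :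
      lp (fun _ : ℕ => ℂ) 2) : ℕ → ℂ) k := by
  obtain ⟨hpast, hctrl, -, hstep⟩ := hu
  induction t using Nat.twoStepInduction generalizing k with
  | zero => simpa [chebyshevOrbit] using hpast (k + 1) (by omega) 0 le_rfl
  | one =>
    have h := hstep (k + 1) (by omega) 0
    have h₁ := hpast (k + 1) (by omega) (-1) (by norm_num)
    have h₂ := hpast (k + 1) (by omega) 0 le_rfl
    have h₃ := hpast (k + 2) (by omega) 0 le_rfl
    have h₄ := hctrl 0
    cases k with
    | zero =>
      simp_all [chebyshevOrbit, deltaCtrl]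
      linear_combination h
    | succ k =>
      have h₅ := hpast (k + 1) (by omega) 0 le_rfl
      simp_all [chebyshevOrbit]
  | more t ih₀ ih₁ =>
    have h := hstep (k + 1) (by omega) (t + 1)
    rw [show ((t + 1 : ℕ) : ℤ) - 1 = (t : ℤ) by push_cast; ring,
      show ((t + 1 : ℕ) : ℤ) + 1 = ((t + 2 : ℕ) : ℤ) by push_cast; ring, ih₀, ih₁, ih₁] at h
    simp only [chebyshevOrbit, lp.coeFn_sub, Pi.sub_apply]
    cases k with
    | zero =>
      have hc : u 0 ((t + 1 : ℕ) : ℤ) = 0 := by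
        rw [hctrl]
        simp [deltaCtrl]
      rw [hH1]
      simp only [zero_add, Nat.sub_self, hc] at h ⊢
      linear_combination h
    | succ k =>
      rw [hH2 _ (k + 1) (by omega)]
      simp only [Nat.add_sub_cancel] at h ⊢
      rw [ih₁] at h
      linear_combination h

end Jacobi

theorem weyl_semiinfinite_representation
    (a b : ℕ → ℂ) (B : ℝ) (hB : 1 ≤ B)
    (ha0 : a 0 = 1) (ha : ∀ n : ℕ, 1 ≤ n → a n ≠ 0)
    (haB : ∀ n : ℕ, 1 ≤ n → ‖a n‖ ≤ B) (hbB : ∀ n : ℕ, 1 ≤ n → ‖b n‖ ≤ B)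
    (H : lp (fun _ : ℕ => ℂ) 2 →L[ℂ] lp (fun _ : ℕ => ℂ) 2)
    (hH1 : ∀ ψ : lp (fun _ : ℕ => ℂ) 2, (H ψ : ℕ → ℂ) 0 = b 1 * (ψ : ℕ → ℂ) 0 + a 1 * (ψ : ℕ → ℂ) 1)
    (hH2 : ∀ ψ : lp (fun _ : ℕ => ℂ) 2, ∀ k : ℕ, 1 ≤ k →
      (H ψ : ℕ → ℂ) k = a k * (ψ : ℕ → ℂ) (k - 1) + b (k + 1) * (ψ : ℕ → ℂ) k
        + a (k + 1) * (ψ : ℕ → ℂ) (k + 1))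
    (u : ℕ → ℤ → ℂ) (hu : IsSol a b deltaCtrl u)
    (z : ℂ) (hz0 : 0 < ‖z‖) (hz1 : ‖z‖ < 1 / (3 * B + 1))
    (lam : ℂ) (hlam : lam = z + 1 / z) :
    IsUnit (H - lam • (1 : lp (fun _ : ℕ => ℂ) 2 →L[ℂ] lp (fun _ : ℕ => ℂ) 2)) ∧
    Summable (fun t : ℕ => ‖z ^ t * u 1 (t : ℤ)‖) ∧
    ((Ring.inverse (H - lam • (1 : lp (fun _ : ℕ => ℂ) 2 →L[ℂ] lp (fun _ : ℕ => ℂ) 2)))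
        (lp.single 2 (0 : ℕ) (1 : ℂ)) : ℕ → ℂ) 0
      = -∑' t : ℕ, z ^ t * u 1 (t : ℤ) := by
  have hz : z ≠ 0 := norm_pos_iff.1 hz0
  have hM : ‖H‖ ≤ 3 * B := jacobi_opNorm_le haB hbB hH1 hH2
  have hzB : ‖z‖ * (3 * B + 1) < 1 := (lt_div_iff₀ (by linarith)).1 hz1
  have hsn := summable_norm_smul_chebyshevOrbit hM (lp.single 2 (0 : ℕ) (1 : ℂ)) hzB
  have hcoord (t : ℕ) : z ^ t * u 1 (t : ℤ) = lp.evalCLM ℂ (fun _ : ℕ => ℂ) 2 0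
      (z ^ t • chebyshevOrbit H (lp.single 2 (0 : ℕ) (1 : ℂ)) t) := by
    rw [hu.eq_chebyshevOrbit ha0 hH1 hH2 t 0]
    rfl
  have hunit : IsUnit (H - lam • (1 : lp (fun _ : ℕ => ℂ) 2 →L[ℂ] lp (fun _ : ℕ => ℂ) 2)) := by
    have hlt : ‖H‖ < ‖lam‖ := by
      have hinv : 3 * B + 1 < ‖z‖⁻¹ := (lt_inv_comm₀ (by linarith) hz0).2 (by simpa using hz1)
      have hle : ‖z‖⁻¹ ≤ ‖lam‖ + ‖z‖ := by
        rw [← norm_inv]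
        simpa [hlam] using norm_sub_le lam z
      nlinarith
    have := spectrum.mem_resolventSet_of_norm_lt_mul
      ((mul_le_of_le_one_right (norm_nonneg H) ContinuousLinearMap.norm_id_le).trans_lt hlt)
    rw [spectrum.mem_resolventSet_iff, Algebra.algebraMap_eq_smul_one] at this
    simpa using this.neg
  refine ⟨hunit, ?_, ?_⟩
  · simp only [hcoord]
    refine Summable.of_nonneg_of_le (fun _ => norm_nonneg _) (fun t => ?_) hsn
    exact lp.norm_apply_le_norm two_ne_zero
      (z ^ t • chebyshevOrbit H (lp.single 2 (0 : ℕ) (1 : ℂ)) t) 0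
  · have hG := sub_smul_one_apply_tsum_chebyshevOrbit hz hsn.of_norm
    rw [← hlam] at hG
    have hsol := congrArg (⇑(Ring.inverse (H - lam •
      (1 : lp (fun _ : ℕ => ℂ) 2 →L[ℂ] lp (fun _ : ℕ => ℂ) 2)))) hG
    rw [← mul_apply_eq_comp, Ring.inverse_mul_cancel _ hunit,
      one_apply_eq_self, map_neg] at hsol
    rw [← neg_eq_iff_eq_neg.2 hsol, tsum_congr hcoord,
      ← (lp.evalCLM ℂ (fun _ : ℕ => ℂ) 2 0).map_tsum hsn.of_norm, lp.coeFn_neg,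
      Pi.neg_apply]
    rfl
end

section
/- Suppose B ≥ 1, a_0 = 1, a_n ≠ 0 for all n ≥ 1, and |a_n| ≤ B, |b_n| ≤ B for all n ≥ 1. Let N ≥ 1, let z ∈ ℂ with 0 < |z| < 1/(3B+1), and set λ = z + 1/z. Then the matrix A^N - λI is invertible, the series Σ_{t=0}^∞ z^t v^δ(1,t) converges absolutely, and the (1,1) entry of (A^N - λI)⁻¹ equals -Σ_{t=0}^∞ z^t v^δ(1,t). -/
/-- The N×N complex Jacobi matrix with diagonal `b 1, …, b N` and off-diagonal
entries `(A)_{k,k+1} = (A)_{k+1,k} = a k` (1-based indexing of rows/columns). -/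
def jacobiMatrix (a b : ℕ → ℂ) (N : ℕ) : Matrix (Fin N) (Fin N) ℂ :=
  Matrix.of fun i j =>
    if (i : ℕ) = (j : ℕ) then b ((i : ℕ) + 1)
    else if (i : ℕ) + 1 = (j : ℕ) then a ((i : ℕ) + 1)
    else if (j : ℕ) + 1 = (i : ℕ) then a ((j : ℕ) + 1)
    else 0

/-- `IsSolFin a b N f v` : `v` is the solution of the finite discrete dynamical
system (on sites `0, …, N+1`) with coefficients `a`, `b` and boundary control `f`. -/
def IsSolFin (a b : ℕ → ℂ) (N : ℕ) (f : ℕ → ℂ) (v : ℕ → ℤ → ℂ) : Prop :=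
  (∀ n : ℕ, 1 ≤ n → n ≤ N + 1 → ∀ t : ℤ, t ≤ 0 → v n t = 0) ∧
  (∀ t : ℕ, v 0 (t : ℤ) = f t) ∧
  (∀ t : ℤ, t < 0 → v 0 t = 0) ∧
  (∀ t : ℤ, v (N + 1) t = 0) ∧
  (∀ n : ℕ, 1 ≤ n → n ≤ N → ∀ t : ℕ,
    v n ((t : ℤ) + 1) + v n ((t : ℤ) - 1) - a n * v (n + 1) (t : ℤ)
      - a (n - 1) * v (n - 1) (t : ℤ) - b n * v n (t : ℤ) = 0)

theorem sum_fin_tridiagonal {M : Type*} [AddCommMonoid M] {N : ℕ} (i : Fin N) (p q r : ℕ → M) :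
    ∑ j : Fin N, (if (i : ℕ) = (j : ℕ) then p j else if (i : ℕ) + 1 = (j : ℕ) then q j
      else if (j : ℕ) + 1 = (i : ℕ) then r j else 0) =
    p i + (if (i : ℕ) + 1 < N then q (i + 1) else 0) + (if 0 < (i : ℕ) then r (i - 1) else 0) := by
  obtain ⟨i, hi⟩ := i
  have hsplit : ∀ j : ℕ, (if i = j then p j else if i + 1 = j then q j
      else if j + 1 = i then r j else 0) =
      (if i = j then p j else 0) + (if i + 1 = j then q j else 0) +
        (if j + 1 = i then r j else 0) := by
    intro j
    split_ifs <;> first | omega | simp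
  have hr : ∀ j : ℕ, (if j + 1 = i then r j else 0) =
      if i - 1 = j then (if 0 < i then r j else 0) else 0 := by
    intro j
    split_ifs <;> first | omega | rfl
  simp only [hsplit]
  rw [Fin.sum_univ_eq_sum_range (fun j => (if i = j then p j else 0) +
    (if i + 1 = j then q j else 0) + (if j + 1 = i then r j else 0)) N]
  simp only [hr, Finset.sum_add_distrib, Finset.sum_ite_eq, Finset.mem_range]
  rw [if_pos hi, if_pos (by omega : i - 1 < N)]

theorem jacobiMatrix_mulVec {a b : ℕ → ℂ} {N : ℕ} (V : ℕ → ℂ) (hV : V (N + 1) = 0)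
    (i : Fin N) :
    (jacobiMatrix a b N).mulVec (fun j => V (j + 1)) i =
      b (i + 1) * V (i + 1) + a (i + 1) * V (i + 2) +
        (if 0 < (i : ℕ) then a i * V i else 0) := by
  have h := sum_fin_tridiagonal i (fun j => b (i + 1) * V (j + 1))
    (fun j => a (i + 1) * V (j + 1)) (fun j => a (j + 1) * V (j + 1))
  simp only [Matrix.mulVec, dotProduct, jacobiMatrix, Matrix.of_apply, ite_mul, zero_mul]
  rw [h]
  congr 1
  · congr 1
    split_ifs with hi
    · rfl
    · have : (i : ℕ) + 2 = N + 1 := by omega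
      rw [this, hV, mul_zero]
  · split_ifs with hi
    · rw [Nat.sub_add_cancel hi]
    · rfl

theorem isUnit_jacobiMatrix_sub_smul_one {a b : ℕ → ℂ} {B : ℝ}
    (haB : ∀ n : ℕ, 1 ≤ n → ‖a n‖ ≤ B) (hbB : ∀ n : ℕ, 1 ≤ n → ‖b n‖ ≤ B)
    (N : ℕ) {lam : ℂ} (hlam : 3 * B < ‖lam‖) :
    IsUnit (jacobiMatrix a b N - lam • (1 : Matrix (Fin N) (Fin N) ℂ)) := by
  have hB : 0 ≤ B := (norm_nonneg _).trans (haB 1 le_rfl)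
  rw [Matrix.isUnit_iff_isUnit_det, isUnit_iff_ne_zero]
  refine det_ne_zero_of_sum_row_lt_diag fun i => ?_
  have hoff : ∑ j ∈ Finset.univ.erase i,
      ‖(jacobiMatrix a b N - lam • (1 : Matrix (Fin N) (Fin N) ℂ)) i j‖ =
      ∑ j : Fin N, (if (i : ℕ) = (j : ℕ) then 0 else if (i : ℕ) + 1 = (j : ℕ) then ‖a (i + 1)‖
      else if (j : ℕ) + 1 = (i : ℕ) then ‖a (j + 1)‖ else 0) := by
    rw [← Finset.sum_erase (a := i) Finset.univ (by simp)]
    refine Finset.sum_congr rfl fun j hj => ?_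
    have hij : i ≠ j := (Finset.ne_of_mem_erase hj).symm
    have hij' : (i : ℕ) ≠ j := fun h => hij (Fin.ext h)
    simp only [jacobiMatrix, Matrix.sub_apply, Matrix.of_apply, Matrix.smul_apply,
      Matrix.one_apply_ne hij, smul_zero, sub_zero, if_neg hij']
    split_ifs <;> simp
  have hdiag : ‖lam‖ - ‖b (i + 1)‖ ≤
      ‖(jacobiMatrix a b N - lam • (1 : Matrix (Fin N) (Fin N) ℂ)) i i‖ := by
    simp only [jacobiMatrix, Matrix.sub_apply, Matrix.of_apply, Matrix.smul_apply,
      Matrix.one_apply_eq, smul_eq_mul, mul_one, if_true]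
    rw [norm_sub_rev]
    exact norm_sub_norm_le _ _
  have hb := hbB (i + 1) (by omega)
  have ha := haB (i + 1) (by omega)
  rw [hoff, sum_fin_tridiagonal i (fun _ => 0) (fun _ => ‖a (i + 1)‖) (fun j => ‖a (j + 1)‖)]
  have ha' := haB (i - 1 + 1) (by omega)
  split_ifs <;> linarith

theorem IsSolFin.norm_le {a b : ℕ → ℂ} {B : ℝ} (hB : 1 ≤ B)
    (haB : ∀ n : ℕ, ‖a n‖ ≤ B) (hbB : ∀ n : ℕ, 1 ≤ n → ‖b n‖ ≤ B)
    {N : ℕ} {f : ℕ → ℂ} (hf : ∀ t, ‖f t‖ ≤ 1) {v : ℕ → ℤ → ℂ} (hv : IsSolFin a b N f v)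
    (t : ℕ) : ∀ n ≤ N + 1, ‖v n (t : ℤ)‖ ≤ (3 * B + 1) ^ t := by
  obtain ⟨hinit, hctrl, -, hright, hrec⟩ := hv
  have hC : 1 ≤ 3 * B + 1 := by linarith
  suffices H : ∀ t : ℕ, (∀ n ≤ N + 1, ‖v n (t : ℤ)‖ ≤ (3 * B + 1) ^ t) ∧
      ∀ n, 1 ≤ n → n ≤ N → ‖v n ((t : ℤ) - 1)‖ ≤ (3 * B + 1) ^ t from (H t).1
  intro t
  induction t with
  | zero =>
    refine ⟨fun n hn => ?_, fun n h1 hn => ?_⟩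
    · rcases Nat.eq_zero_or_pos n with rfl | h1
      · simpa using (hctrl 0) ▸ hf 0
      · simp [hinit n h1 hn 0 le_rfl]
    · rw [hinit n h1 (by omega) _ (by simp)]
      simp
  | succ t ih =>
    obtain ⟨ih, ih'⟩ := ih
    have hpow : (3 * B + 1) ^ t ≤ (3 * B + 1) ^ (t + 1) := pow_le_pow_right₀ hC (by omega)
    refine ⟨fun n hn => ?_, fun n h1 hn => ?_⟩
    · rcases Nat.eq_zero_or_pos n with rfl | h1
      · rw [hctrl]
        exact (hf _).trans (one_le_pow₀ hC)
      rcases hn.eq_or_lt with rfl | hn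
      · rw [hright, norm_zero]
        positivity
      have hn : n ≤ N := by omega
      have heq : v n ((t + 1 : ℕ) : ℤ) = a n * v (n + 1) t + a (n - 1) * v (n - 1) t +
          b n * v n t - v n ((t : ℤ) - 1) := by
        push_cast
        linear_combination hrec n h1 hn t
      have hmul : ∀ c w : ℂ, ‖c‖ ≤ B → ‖w‖ ≤ (3 * B + 1) ^ t →
          ‖c * w‖ ≤ B * (3 * B + 1) ^ t := fun c w hc hw => by
        rw [norm_mul]
        gcongr
      calc ‖v n ((t + 1 : ℕ) : ℤ)‖
          ≤ ‖a n * v (n + 1) t‖ + ‖a (n - 1) * v (n - 1) t‖ + ‖b n * v n t‖ +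
              ‖v n ((t : ℤ) - 1)‖ := by
            rw [heq]
            exact (norm_sub_le _ _).trans (by gcongr; exact norm_add₃_le)
        _ ≤ B * (3 * B + 1) ^ t + B * (3 * B + 1) ^ t + B * (3 * B + 1) ^ t +
              (3 * B + 1) ^ t := by
            gcongr
            · exact hmul _ _ (haB _) (ih _ (by omega))
            · exact hmul _ _ (haB _) (ih _ (by omega))
            · exact hmul _ _ (hbB _ h1) (ih _ (by omega))
            · exact ih' n h1 hn
        _ = (3 * B + 1) ^ (t + 1) := by ring
    · push_cast
      rw [add_sub_cancel_right]
      exact (ih n (by omega)).trans hpow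

theorem weyl_finite_representation
    (a b : ℕ → ℂ) (B : ℝ) (hB : 1 ≤ B)
    (ha0 : a 0 = 1) (ha : ∀ n : ℕ, 1 ≤ n → a n ≠ 0)
    (haB : ∀ n : ℕ, 1 ≤ n → ‖a n‖ ≤ B) (hbB : ∀ n : ℕ, 1 ≤ n → ‖b n‖ ≤ B)
    (N : ℕ) (hN : 1 ≤ N)
    (v : ℕ → ℤ → ℂ) (hv : IsSolFin a b N deltaCtrl v)
    (z : ℂ) (hz0 : 0 < ‖z‖) (hz1 : ‖z‖ < 1 / (3 * B + 1))
    (lam : ℂ) (hlam : lam = z + 1 / z) :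
    IsUnit (jacobiMatrix a b N - lam • (1 : Matrix (Fin N) (Fin N) ℂ)) ∧
    Summable (fun t : ℕ => ‖z ^ t * v 1 (t : ℤ)‖) ∧
    (jacobiMatrix a b N - lam • (1 : Matrix (Fin N) (Fin N) ℂ))⁻¹
        ⟨0, by omega⟩ ⟨0, by omega⟩
      = -∑' t : ℕ, z ^ t * v 1 (t : ℤ) := by
  have hz : z ≠ 0 := norm_pos_iff.mp hz0
  have hC : 0 < 3 * B + 1 := by linarith
  have hzC : ‖z‖ * (3 * B + 1) < 1 := (lt_div_iff₀ hC).mp hz1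
  have haB' : ∀ n, ‖a n‖ ≤ B := fun n => by
    rcases Nat.eq_zero_or_pos n with rfl | h
    · simpa [ha0] using hB
    · exact haB n h
  have hlam_norm : 3 * B < ‖lam‖ := by
    have h1 : 3 * B + 1 < ‖1 / z‖ := by
      rw [norm_div, norm_one, lt_div_iff₀ hz0]
      linarith
    have h2 : ‖z‖ < 1 := by nlinarith
    have h3 : ‖1 / z‖ - ‖z‖ ≤ ‖lam‖ := by
      rw [hlam, add_comm]
      exact norm_sub_le_norm_add _ _
    linarith
  have hunit := isUnit_jacobiMatrix_sub_smul_one haB hbB N hlam_norm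
  have hf : ∀ t, ‖deltaCtrl t‖ ≤ 1 := fun t => by
    unfold deltaCtrl
    split_ifs <;> simp
  have hsum : ∀ n ≤ N + 1, Summable (fun t : ℕ => ‖z ^ t * v n (t : ℤ)‖) := fun n hn => by
    refine Summable.of_nonneg_of_le (fun _ => norm_nonneg _) (fun t => ?_)
      (summable_geometric_of_lt_one (by positivity) hzC)
    rw [norm_mul, norm_pow, mul_pow]
    gcongr
    exact hv.norm_le hB haB' hbB hf t n hn
  refine ⟨hunit, hsum 1 (by omega), ?_⟩
  obtain ⟨hinit, hctrl, -, hright, hrec⟩ := hv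
  set V : ℕ → ℂ := fun n => ∑' t : ℕ, z ^ t * v n (t : ℤ) with hVdef
  have hV : ∀ n ≤ N + 1, HasSum (fun t : ℕ => z ^ t * v n (t : ℤ)) (V n) :=
    fun n hn => (hsum n hn).of_norm.hasSum
  have hVright : V (N + 1) = 0 := by simp [hVdef, hright]
  have hVleft : V 0 = 1 := by
    rw [hVdef]
    simp only [hctrl]
    rw [tsum_eq_single 0 fun t ht => by simp [deltaCtrl, ht]]
    simp [deltaCtrl]
  have hVrec : ∀ n, 1 ≤ n → n ≤ N →
      b n * V n + a n * V (n + 1) + a (n - 1) * V (n - 1) = lam * V n := by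
    intro n h1 hn
    have hshift : HasSum (fun t : ℕ => z ^ (t + 1) * v n ((t + 1 : ℕ) : ℤ)) (V n) := by
      rw [hasSum_nat_add_iff (f := fun t : ℕ => z ^ t * v n (t : ℤ)) 1]
      simpa [hinit n h1 (by omega) 0 le_rfl] using hV n (by omega)
    have hback : HasSum (fun t : ℕ => z ^ t * v n ((t : ℤ) - 1)) (z * V n) := by
      rw [← hasSum_nat_add_iff' 1]
      simpa [hinit n h1 (by omega) (-1) (by simp), pow_succ', mul_assoc] using
        (hV n (by omega)).mul_left z
    have hcomb := ((hV n (by omega)).mul_left (b n)).add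
      ((hV (n + 1) (by omega)).mul_left (a n)) |>.add
      ((hV (n - 1) (by omega)).mul_left (a (n - 1)))
    have hlamV := (hshift.mul_left (1 / z)).add hback
    have heq : lam * V n = 1 / z * V n + z * V n := by rw [hlam]; ring
    rw [heq]
    refine hcomb.unique ?_
    convert hlamV using 2 with t
    push_cast
    have hpow : 1 / z * (z ^ (t + 1) * v n ((t : ℤ) + 1)) = z ^ t * v n ((t : ℤ) + 1) := by
      rw [pow_succ']
      field_simp
    linear_combination -z ^ t * hrec n h1 hn t - hpow
  have hmul : (jacobiMatrix a b N - lam • (1 : Matrix (Fin N) (Fin N) ℂ)).mulVec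
      (fun j => V (j + 1)) = -Pi.single ⟨0, by omega⟩ 1 := by
    funext i
    have h := hVrec (i + 1) (by omega) (by omega)
    rw [Matrix.sub_mulVec, Pi.sub_apply, jacobiMatrix_mulVec V hVright, Matrix.smul_mulVec,
      Matrix.one_mulVec, Pi.smul_apply, smul_eq_mul, ← h]
    rcases Nat.eq_zero_or_pos (i : ℕ) with hi | hi
    · have : i = ⟨0, by omega⟩ := Fin.ext hi
      simp [this, ha0, hVleft]
    · have : i ≠ ⟨0, by omega⟩ := fun h => hi.ne' (congrArg Fin.val h)
      simp [hi, this]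
  have hdet := (Matrix.isUnit_iff_isUnit_det _).mp hunit
  have hinv := congrArg
    (fun w => (jacobiMatrix a b N - lam • (1 : Matrix (Fin N) (Fin N) ℂ))⁻¹.mulVec w
      ⟨0, by omega⟩) hmul
  simp only [Matrix.mulVec_mulVec, Matrix.nonsing_inv_mul _ hdet, Matrix.one_mulVec,
    Matrix.mulVec_neg, Matrix.mulVec_single_one, Pi.neg_apply, Matrix.col_apply] at hinv
  rw [← neg_eq_iff_eq_neg, ← hinv]
end

section
/- Let N ≥ 1, a_0 = 1 and a_n ≠ 0 for all n ≥ 1. Let z ∈ ℂ be such that A^N - zI is invertible. Define φ⁺ : {0,1,...,N+1} → ℂ by φ⁺_{N+1} = 0, φ⁺_N = 1 and the backward recursion a_{n-1}φ⁺_{n-1} + b_nφ⁺_n + a_nφ⁺_{n+1} = zφ⁺_n for n = N, N-1, ..., 1. Then φ⁺_0 ≠ 0 and the (1,1) entry of (A^N - zI)⁻¹ equals -φ⁺_1/φ⁺_0. -/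
/-- Row `i` of `A - z` applied to a sequence vanishing at `N + 1`. The missing boundary term
`a 0 * f 0` is all that separates the first row from the three-term recurrence. -/
lemma jacobiMatrix_sub_smul_one_mulVec (a b : ℕ → ℂ) (N : ℕ) (z : ℂ) (f : ℕ → ℂ)
    (hf : f (N + 1) = 0) (i : Fin N) :
    ((jacobiMatrix a b N - z • (1 : Matrix (Fin N) (Fin N) ℂ)).mulVec
        fun j : Fin N => f ((j : ℕ) + 1)) i =
      (if (i : ℕ) = 0 then 0 else a i * f i) + b ((i : ℕ) + 1) * f ((i : ℕ) + 1) +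
        a ((i : ℕ) + 1) * f ((i : ℕ) + 2) - z * f ((i : ℕ) + 1) := by
  rw [Matrix.sub_mulVec, Matrix.smul_mulVec, Matrix.one_mulVec]
  simp only [Pi.sub_apply, Pi.smul_apply, smul_eq_mul]
  congr 1
  obtain ⟨i, hi⟩ := i
  simp only [Matrix.mulVec, dotProduct, jacobiMatrix, Matrix.of_apply]
  rw [Fin.sum_univ_eq_sum_range (fun j : ℕ => (if i = j then b (i + 1)
    else if i + 1 = j then a (i + 1) else if j + 1 = i then a (j + 1) else 0) * f (j + 1)) N]
  have hsplit : ∀ j : ℕ, (if i = j then b (i + 1)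
      else if i + 1 = j then a (i + 1) else if j + 1 = i then a (j + 1) else 0) * f (j + 1) =
      (if j + 1 = i then a i * f i else 0) + (if i = j then b (i + 1) * f (i + 1) else 0) +
        (if i + 1 = j then a (i + 1) * f (i + 2) else 0) := by
    intro j
    grind
  simp only [hsplit, Finset.sum_add_distrib, Finset.sum_ite_eq, Finset.mem_range, if_pos hi]
  congr 1
  · congr 1
    cases i with
    | zero => simp
    | succ k =>
      have hk : k < N := by omega
      simp [hk]
  · split_ifs with h
    · rfl
    · have : i + 2 = N + 1 := by omega
      simp [this, hf]

theorem weyl_m_function_finite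
    (a b : ℕ → ℂ) (N : ℕ) (hN : 1 ≤ N)
    (ha0 : a 0 = 1) (ha : ∀ n : ℕ, 1 ≤ n → a n ≠ 0)
    (z : ℂ)
    (hinv : IsUnit (jacobiMatrix a b N - z • (1 : Matrix (Fin N) (Fin N) ℂ)))
    (φ : ℕ → ℂ) (hφtop : φ (N + 1) = 0) (hφN : φ N = 1)
    (hφ : ∀ n : ℕ, 1 ≤ n → n ≤ N →
      a (n - 1) * φ (n - 1) + b n * φ n + a n * φ (n + 1) = z * φ n) :
    φ 0 ≠ 0 ∧
    (jacobiMatrix a b N - z • (1 : Matrix (Fin N) (Fin N) ℂ))⁻¹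
        ⟨0, by omega⟩ ⟨0, by omega⟩ = -φ 1 / φ 0 := by
  set M := jacobiMatrix a b N - z • (1 : Matrix (Fin N) (Fin N) ℂ)
  set v : Fin N → ℂ := fun j => φ ((j : ℕ) + 1) with hv
  have hMv : M.mulVec v = Pi.single ⟨0, by omega⟩ (-φ 0) := by
    ext i
    rw [jacobiMatrix_sub_smul_one_mulVec a b N z φ hφtop i]
    have h := hφ ((i : ℕ) + 1) (by omega) (by omega)
    rw [Nat.add_sub_cancel] at h
    by_cases hi : (i : ℕ) = 0
    · rw [show i = ⟨0, by omega⟩ from Fin.ext hi] at h ⊢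
      simp only [ha0, zero_add, one_mul] at h
      simp only [if_true, Pi.single_eq_same, zero_add]
      linear_combination h
    · rw [Pi.single_eq_of_ne (by simpa [Fin.ext_iff] using hi), if_neg hi]
      linear_combination h
  have hinv_mul : M⁻¹ * M = 1 :=
    Matrix.nonsing_inv_mul M ((Matrix.isUnit_iff_isUnit_det M).mp hinv)
  have hsolve : v = M⁻¹.mulVec (Pi.single ⟨0, by omega⟩ (-φ 0)) := by
    rw [← hMv, Matrix.mulVec_mulVec, hinv_mul, Matrix.one_mulVec]
  have hφ0 : φ 0 ≠ 0 := by
    intro h0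
    have h := congrFun hsolve ⟨N - 1, by omega⟩
    simp [hv, h0, Nat.sub_add_cancel hN, hφN] at h
  refine ⟨hφ0, ?_⟩
  have h := congrFun hsolve ⟨0, by omega⟩
  simp only [hv, Matrix.mulVec_single, Pi.smul_apply, Matrix.col_apply, MulOpposite.smul_eq_mul_unop,
    MulOpposite.unop_op, zero_add] at h
  rw [eq_div_iff hφ0]
  linear_combination h
end

section
/- Let N ≥ 1, a_0 = 1 and a_n ≠ 0 for all n ≥ 1. Let z ∈ ℂ be such that A^N - zI is invertible. Define φ⁺ : {0,1,...,N+1} → ℂ by φ⁺_{N+1} = 0, φ⁺_N = 1 and the backward recursion a_{n-1}φ⁺_{n-1} + b_nφ⁺_n + a_nφ⁺_{n+1} = zφ⁺_n for n = N, N-1, ..., 1; define p : {0,1,...,N} → ℂ by p_0 = 0, p_1 = 1 and the forward recursion a_{n-1}p_{n-1} + b_np_n + a_np_{n+1} = zp_n for n = 1, ..., N-1. Set W = a_0(p_0φ⁺_1 - p_1φ⁺_0) = -φ⁺_0. Then W ≠ 0 and for all 1 ≤ m, n ≤ N the (m,n) entry of (A^N - zI)⁻¹ equals p_{min(m,n)}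 φ⁺_{max(m,n)} / W. -/
/-- A row of `jacobiMatrix a b N - z` applied to a sequence: the three-term expression,
corrected by the two boundary terms. -/
theorem sum_jacobiMatrix_sub_smul_one_mul (a b f : ℕ → ℂ) (N : ℕ) (z : ℂ) (i : Fin N) :
    ∑ j : Fin N, (jacobiMatrix a b N - z • (1 : Matrix (Fin N) (Fin N) ℂ)) i j * f ((j : ℕ) + 1)
      = a i * f i + (b ((i : ℕ) + 1) - z) * f ((i : ℕ) + 1)
        + a ((i : ℕ) + 1) * f ((i : ℕ) + 2)
        - (if (i : ℕ) = 0 then a 0 * f 0 else 0)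
        - (if (i : ℕ) + 1 = N then a N * f (N + 1) else 0) := by
  obtain ⟨i, hi⟩ := i
  have entry (j : Fin N) :
      (jacobiMatrix a b N - z • (1 : Matrix (Fin N) (Fin N) ℂ)) ⟨i, hi⟩ j * f ((j : ℕ) + 1)
        = (if i = (j : ℕ) then (b (i + 1) - z) * f (i + 1) else 0)
          + (if i + 1 = (j : ℕ) then a (i + 1) * f (i + 2) else 0)
          + (if i = (j : ℕ) + 1 then a i * f i else 0) := by
    simp only [jacobiMatrix, Matrix.sub_apply, Matrix.of_apply, Matrix.smul_apply,
      Matrix.one_apply, Fin.ext_iff, smul_eq_mul]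
    grind
  have below : ∑ j ∈ Finset.range N, (if i = j + 1 then a i * f i else 0)
      = a i * f i - (if i = 0 then a 0 * f 0 else 0) := by
    cases i with
    | zero => simp
    | succ k => simp [Finset.sum_ite_eq, Nat.lt_of_succ_lt hi]
  have above : ∑ j ∈ Finset.range N, (if i + 1 = j then a (i + 1) * f (i + 2) else 0)
      = a (i + 1) * f (i + 2) - (if i + 1 = N then a N * f (N + 1) else 0) := by
    rw [Finset.sum_ite_eq]
    grind
  rw [Finset.sum_congr rfl fun j _ => entry j,
    Fin.sum_univ_eq_sum_range (fun j => (if i = j then (b (i + 1) - z) * f (i + 1) else 0)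
      + (if i + 1 = j then a (i + 1) * f (i + 2) else 0)
      + (if i = j + 1 then a i * f i else 0)) N,
    Finset.sum_add_distrib, Finset.sum_add_distrib, below, above, Finset.sum_ite_eq,
    if_pos (Finset.mem_range.mpr hi)]
  ring

/-- The Wronskian of two solutions of the three-term recursion is constant. -/
theorem wronskian_eq_of_recursion (a b p φ : ℕ → ℂ) (N : ℕ) (z : ℂ)
    (hφ : ∀ n : ℕ, 1 ≤ n → n ≤ N →
      a (n - 1) * φ (n - 1) + b n * φ n + a n * φ (n + 1) = z * φ n)
    (hp : ∀ n : ℕ, 1 ≤ n → n ≤ N →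
      a (n - 1) * p (n - 1) + b n * p n + a n * p (n + 1) = z * p n)
    (k : ℕ) (hk : k ≤ N) :
    a k * (p k * φ (k + 1) - p (k + 1) * φ k) = a 0 * (p 0 * φ 1 - p 1 * φ 0) := by
  induction k with
  | zero => rfl
  | succ k ih =>
    have h1 := hφ (k + 1) (by omega) hk
    have h2 := hp (k + 1) (by omega) hk
    rw [← ih (by omega)]
    simp only [Nat.add_sub_cancel] at h1 h2
    linear_combination p (k + 1) * h1 - φ (k + 1) * h2

theorem green_function_finite
    (a b : ℕ → ℂ) (N : ℕ) (hN : 1 ≤ N)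
    (ha0 : a 0 = 1) (ha : ∀ n : ℕ, 1 ≤ n → a n ≠ 0)
    (z : ℂ)
    (hinv : IsUnit (jacobiMatrix a b N - z • (1 : Matrix (Fin N) (Fin N) ℂ)))
    (φ : ℕ → ℂ) (hφtop : φ (N + 1) = 0) (hφN : φ N = 1)
    (hφ : ∀ n : ℕ, 1 ≤ n → n ≤ N →
      a (n - 1) * φ (n - 1) + b n * φ n + a n * φ (n + 1) = z * φ n)
    (p : ℕ → ℂ) (hp0 : p 0 = 0) (hp1 : p 1 = 1)
    (hp : ∀ n : ℕ, 1 ≤ n → n ≤ N - 1 →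
      a (n - 1) * p (n - 1) + b n * p n + a n * p (n + 1) = z * p n)
    (W : ℂ) (hW : W = a 0 * (p 0 * φ 1 - p 1 * φ 0)) :
    W ≠ 0 ∧ W = -φ 0 ∧
    ∀ m n : Fin N,
      (jacobiMatrix a b N - z • (1 : Matrix (Fin N) (Fin N) ℂ))⁻¹ m n
        = p (min ((m : ℕ) + 1) ((n : ℕ) + 1)) * φ (max ((m : ℕ) + 1) ((n : ℕ) + 1)) / W := by
  have hWφ : W = -φ 0 := by rw [hW, ha0, hp0, hp1]; ring
  have hdet := (Matrix.isUnit_iff_isUnit_det _).mp hinv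
  have hW0 : W ≠ 0 := by
    intro h0
    have hφ0 : φ 0 = 0 := by simpa [h0] using hWφ
    have hker : (jacobiMatrix a b N - z • (1 : Matrix (Fin N) (Fin N) ℂ)).mulVec
        (fun j : Fin N => φ ((j : ℕ) + 1)) = 0 := by
      funext i
      have h1 := hφ ((i : ℕ) + 1) (by omega) i.isLt
      simp only [Nat.add_sub_cancel] at h1
      simp only [Matrix.mulVec, dotProduct, sum_jacobiMatrix_sub_smul_one_mul, hφ0, hφtop,
        mul_zero, ite_self, sub_zero, Pi.zero_apply]
      linear_combination h1
    have hlast := congrFun (Matrix.mulVec_injective_of_isUnit hinv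
      (hker.trans (Matrix.mulVec_zero _).symm)) ⟨N - 1, by omega⟩
    simp [Nat.sub_add_cancel hN, hφN] at hlast
  refine ⟨hW0, hWφ, fun m n => ?_⟩
  suffices h : (jacobiMatrix a b N - z • (1 : Matrix (Fin N) (Fin N) ℂ))⁻¹
      = Matrix.of fun m n : Fin N =>
        p (min ((m : ℕ) + 1) ((n : ℕ) + 1)) * φ (max ((m : ℕ) + 1) ((n : ℕ) + 1)) / W by
    rw [h, Matrix.of_apply]
  refine Matrix.inv_eq_right_inv ?_
  ext i n
  have hrow := sum_jacobiMatrix_sub_smul_one_mul a b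
    (fun k => p (min k ((n : ℕ) + 1)) * φ (max k ((n : ℕ) + 1)) / W) N z i
  rw [Matrix.mul_apply]
  simp only [Matrix.of_apply]
  rw [hrow]
  obtain ⟨i, hi⟩ := i
  obtain ⟨n, hn⟩ := n
  have hNn : max (N + 1) (n + 1) = N + 1 := by omega
  simp only [hNn, hφtop, Nat.zero_min, hp0, mul_zero, zero_mul, zero_div, ite_self, sub_zero,
    Matrix.one_apply, Fin.mk.injEq]
  rcases lt_trichotomy i n with h | rfl | h
  · have h1 := hp (i + 1) (by omega) (by omega)
    rw [if_neg h.ne, min_eq_left (by omega), min_eq_left (by omega), min_eq_left (by omega),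
      max_eq_right (by omega), max_eq_right (by omega), max_eq_right (by omega)]
    simp only [Nat.add_sub_cancel] at h1
    linear_combination φ (n + 1) / W * h1
  · have h1 := hφ (i + 1) (by omega) hi
    have hwr := wronskian_eq_of_recursion a b p φ (N - 1) z
      (fun k h h' => hφ k h (by omega)) hp i (by omega)
    rw [← hW] at hwr
    rw [if_pos rfl, min_eq_left (by omega), min_eq_left (by omega), min_eq_right (by omega),
      max_eq_right (by omega), max_eq_right (by omega), max_eq_left (by omega)]
    simp only [Nat.add_sub_cancel] at h1
    field_simp
    linear_combination p (i + 1) * h1 + hwr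
  · have h1 := hφ (i + 1) (by omega) hi
    rw [if_neg h.ne', min_eq_right (by omega), min_eq_right (by omega), min_eq_right (by omega),
      max_eq_left (by omega), max_eq_left (by omega), max_eq_left (by omega)]
    simp only [Nat.add_sub_cancel] at h1
    linear_combination p (n + 1) / W * h1
end

section
/- Suppose a_0 = 1 and a_n ≠ 0 for all n ≥ 1. Let z ∈ ℂ be such that H - zI is invertible in the Banach algebra of continuous linear operators on ℓ²(ℕ,ℂ). Suppose ψ : ℕ → ℂ (written ψ_0, ψ_1, ψ_2, ...) satisfies a_{n-1}ψ_{n-1} + b_nψ_n + a_nψ_{n+1} = zψ_n for all n ≥ 1, the sequence (ψ_1, ψ_2, ...) lies in ℓ²(ℕ,ℂ), and ψ is not identically zero. Then ψ_0 ≠ 0 and the first coordinate of (H - zI)⁻¹ e₁ equals -ψ_1/ψ_0. -/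
/-- A sequence solving the three-term recurrence is mapped by the shifted Jacobi operator
to a multiple of the first basis vector. -/
lemma jacobi_sub_smul_apply_solution
    (a b : ℕ → ℂ) (ha0 : a 0 = 1)
    (H : lp (fun _ : ℕ => ℂ) 2 →L[ℂ] lp (fun _ : ℕ => ℂ) 2)
    (hH1 : ∀ ψ : lp (fun _ : ℕ => ℂ) 2, H ψ 0 = b 1 * ψ 0 + a 1 * ψ 1)
    (hH2 : ∀ ψ : lp (fun _ : ℕ => ℂ) 2, ∀ k : ℕ, 1 ≤ k →
      H ψ k = a k * ψ (k - 1) + b (k + 1) * ψ k + a (k + 1) * ψ (k + 1))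
    (z : ℂ) (ψ : ℕ → ℂ)
    (hψ : ∀ n : ℕ, 1 ≤ n → a (n - 1) * ψ (n - 1) + b n * ψ n + a n * ψ (n + 1) = z * ψ n)
    (φ : lp (fun _ : ℕ => ℂ) 2) (hφ : ∀ n, φ n = ψ (n + 1)) :
    (H - z • (1 : lp (fun _ : ℕ => ℂ) 2 →L[ℂ] lp (fun _ : ℕ => ℂ) 2)) φ =
      (-ψ 0) • lp.single 2 (0 : ℕ) (1 : ℂ) := by
  ext k
  change H φ k - z * φ k = (-ψ 0) * (lp.single 2 (0 : ℕ) (1 : ℂ) : lp (fun _ : ℕ => ℂ) 2) k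
  rcases k with _ | k
  · have h := hψ 1 le_rfl
    simp only [Nat.sub_self, ha0] at h
    rw [hH1, lp.single_apply_self, hφ, hφ]
    linear_combination h
  · have h := hψ (k + 2) (by lia)
    rw [hH2 _ _ (by lia), lp.single_apply_ne _ _ _ (by lia), hφ, hφ, hφ]
    simp only [Nat.add_sub_cancel, Nat.add_succ_sub_one] at h ⊢
    linear_combination h


theorem weyl_m_function_semiinfinite
    (a b : ℕ → ℂ)
    (ha0 : a 0 = 1) (ha : ∀ n : ℕ, 1 ≤ n → a n ≠ 0)
    (H : lp (fun _ : ℕ => ℂ) 2 →L[ℂ] lp (fun _ : ℕ => ℂ) 2)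
    (hH1 : ∀ ψ : lp (fun _ : ℕ => ℂ) 2, (H ψ : ℕ → ℂ) 0 = b 1 * (ψ : ℕ → ℂ) 0 + a 1 * (ψ : ℕ → ℂ) 1)
    (hH2 : ∀ ψ : lp (fun _ : ℕ => ℂ) 2, ∀ k : ℕ, 1 ≤ k →
      (H ψ : ℕ → ℂ) k = a k * (ψ : ℕ → ℂ) (k - 1) + b (k + 1) * (ψ : ℕ → ℂ) k
        + a (k + 1) * (ψ : ℕ → ℂ) (k + 1))
    (z : ℂ)
    (hinv : IsUnit (H - z • (1 : lp (fun _ : ℕ => ℂ) 2 →L[ℂ] lp (fun _ : ℕ => ℂ) 2)))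
    (ψ : ℕ → ℂ)
    (hψeq : ∀ n : ℕ, 1 ≤ n → a (n - 1) * ψ (n - 1) + b n * ψ n + a n * ψ (n + 1) = z * ψ n)
    (hψl2 : Memℓp (fun n : ℕ => ψ (n + 1)) 2)
    (hψne : ψ ≠ 0) :
    ψ 0 ≠ 0 ∧
    ((Ring.inverse (H - z • (1 : lp (fun _ : ℕ => ℂ) 2 →L[ℂ] lp (fun _ : ℕ => ℂ) 2)))
        (lp.single 2 (0 : ℕ) (1 : ℂ)) : ℕ → ℂ) 0 = -ψ 1 / ψ 0 := by
  set T := H - z • (1 : lp (fun _ : ℕ => ℂ) 2 →L[ℂ] lp (fun _ : ℕ => ℂ) 2)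
  let φ : lp (fun _ : ℕ => ℂ) 2 := ⟨fun n => ψ (n + 1), hψl2⟩
  have hTφ : T φ = (-ψ 0) • lp.single 2 (0 : ℕ) (1 : ℂ) :=
    jacobi_sub_smul_apply_solution a b ha0 H hH1 hH2 z ψ hψeq φ fun _ => rfl
  have hleft : ∀ x, Ring.inverse T (T x) = x := fun x =>
    DFunLike.congr_fun (Ring.inverse_mul_cancel T hinv) x
  have hφ : φ = (-ψ 0) • Ring.inverse T (lp.single 2 (0 : ℕ) (1 : ℂ)) := by
    rw [← map_smul, ← hTφ, hleft]
  have hψ0 : ψ 0 ≠ 0 := by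
    intro h0
    rw [h0, neg_zero, zero_smul] at hφ
    refine hψne (funext fun n => ?_)
    rcases n with _ | n
    · exact h0
    · exact congrArg (fun x : lp (fun _ : ℕ => ℂ) 2 => x n) hφ
  refine ⟨hψ0, ?_⟩
  have h1 : ψ 1 = (-ψ 0) * Ring.inverse T (lp.single 2 (0 : ℕ) (1 : ℂ)) 0 :=
    congrArg (fun x : lp (fun _ : ℕ => ℂ) 2 => x 0) hφ
  rw [eq_div_iff hψ0]
  linear_combination h1
end

section
/- (Autonne–Takagi factorization) For every n ≥ 1 and every complex symmetric matrix A ∈ ℂ^{n×n} (i.e. Aᵀ = A), there exist a unitary matrix U ∈ ℂ^{n×n} and nonnegative real numbers d_1, ..., d_n such that U A Uᵀ = diag(d_1, ..., d_n). -/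
open scoped InnerProductSpace in
/-- A conjugate-linear map that is symmetric for the bilinear form `(x, y) ↦ ⟪T x, y⟫` and
preserves a nonzero subspace has there a unit coneigenvector with nonnegative coneigenvalue. -/
theorem exists_unit_coneigenvector {E : Type*} [NormedAddCommGroup E] [InnerProductSpace ℂ E]
    [FiniteDimensional ℂ E] (T : E →ₗ⋆[ℂ] E) (hT : ∀ x y, ⟪T x, y⟫_ℂ = ⟪T y, x⟫_ℂ)
    (W : Submodule ℂ E) (hW : W ≠ ⊥) (hTW : ∀ x ∈ W, T x ∈ W) :
    ∃ x ∈ W, ‖x‖ = 1 ∧ ∃ d : ℝ, 0 ≤ d ∧ T x = (d : ℂ) • x := by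
  let _ : InnerProductSpace ℝ E := InnerProductSpace.rclikeToReal ℂ E
  have : FiniteDimensional ℝ E := FiniteDimensional.complexToReal E
  let S : E →ₗ[ℝ] E :=
    { toFun := T
      map_add' := T.map_add
      map_smul' := fun r x => by
        rw [← Complex.coe_smul r x, T.map_smulₛₗ, Complex.conj_ofReal, Complex.coe_smul]; rfl }
  have hS : S.IsSymmetric := fun x y => by
    rw [real_inner_comm]
    change ⟪y, T x⟫_ℝ = ⟪x, T y⟫_ℝ
    rw [real_inner_eq_re_inner ℂ, real_inner_eq_re_inner ℂ, ← inner_conj_symm, hT x y,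
      inner_conj_symm]
  let K : Submodule ℝ E := W.restrictScalars ℝ
  have hK : ∀ x ∈ K, S x ∈ K := hTW
  obtain ⟨w, hw, hw0⟩ := W.exists_mem_ne_zero_of_ne_bot hW
  obtain ⟨μ, hμ⟩ : ∃ μ : ℝ, Module.End.HasEigenvalue (S.restrict hK) μ := by
    by_contra! h
    have hsub := (hS.restrict_invariant hK).subsingleton_of_no_eigenvalue_finiteDimensional
      fun μ => by simpa [Module.End.HasEigenvalue, Module.End.HasUnifEigenvalue] using h μ
    exact hw0 (congrArg Subtype.val (hsub.elim (⟨w, hw⟩ : K) 0))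
  obtain ⟨⟨x, hx⟩, hμx⟩ := hμ.exists_hasEigenvector
  have hx0 : x ≠ 0 := fun h => hμx.2 (Subtype.ext h)
  have hTx : T x = (μ : ℂ) • x := by
    rw [Complex.coe_smul]
    exact congrArg Subtype.val hμx.apply_eq_smul
  obtain ⟨y, hy, hy0, d, hd, hTy⟩ :
      ∃ y ∈ W, y ≠ 0 ∧ ∃ d : ℝ, 0 ≤ d ∧ T y = (d : ℂ) • y := by
    rcases le_total 0 μ with h | h
    · exact ⟨x, hx, hx0, μ, h, hTx⟩
    · refine ⟨Complex.I • x, W.smul_mem _ hx, smul_ne_zero Complex.I_ne_zero hx0, -μ,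
        neg_nonneg.2 h, ?_⟩
      rw [T.map_smulₛₗ, hTx, Complex.conj_I, smul_smul, smul_smul]
      push_cast
      ring_nf
  refine ⟨((‖y‖⁻¹ : ℝ) : ℂ) • y, W.smul_mem _ hy, ?_, d, hd, ?_⟩
  · rw [norm_smul, Complex.norm_real, norm_inv, norm_norm, inv_mul_cancel₀ (norm_ne_zero_iff.2 hy0)]
  · rw [T.map_smulₛₗ, hTy, Complex.conj_ofReal, smul_comm]

open scoped InnerProductSpace in
theorem exists_orthonormal_coneigenvectors {E : Type*} [NormedAddCommGroup E]
    [InnerProductSpace ℂ E] [FiniteDimensional ℂ E] (T : E →ₗ⋆[ℂ] E)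
    (hT : ∀ x y, ⟪T x, y⟫_ℂ = ⟪T y, x⟫_ℂ) (k : ℕ) (hk : k ≤ Module.finrank ℂ E) :
    ∃ (v : Fin k → E) (d : Fin k → ℝ), Orthonormal ℂ v ∧
      ∀ i, 0 ≤ d i ∧ T (v i) = (d i : ℂ) • v i := by
  induction k with
  | zero => exact ⟨Fin.elim0, Fin.elim0, ⟨fun i => i.elim0, fun i => i.elim0⟩, fun i => i.elim0⟩
  | succ k ih =>
    obtain ⟨v, d, hv, hd⟩ := ih (by omega)
    let W := (Submodule.span ℂ (Set.range v))ᗮ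
    have mem_W (x : E) : x ∈ W ↔ ∀ i, ⟪v i, x⟫_ℂ = 0 := by
      rw [← Submodule.span_singleton_le_iff_mem, Submodule.le_orthogonal_iff_le_orthogonal,
        Submodule.span_le, Set.range_subset_iff]
      exact forall_congr' fun i => by
        rw [SetLike.mem_coe, Submodule.mem_orthogonal_singleton_iff_inner_left]
    have hW : W ≠ ⊥ := by
      intro h
      have h1 := Submodule.orthogonal_eq_bot_iff.1 h
      have h2 := finrank_span_eq_card hv.linearIndependent
      rw [h1, finrank_top, Fintype.card_fin] at h2
      omega
    have hTW : ∀ x ∈ W, T x ∈ W := by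
      intro x hx
      rw [mem_W] at hx ⊢
      intro i
      rw [inner_eq_zero_symm, hT, (hd i).2, inner_smul_left, hx i, mul_zero]
    obtain ⟨x, hx, hx1, c, hc, hTx⟩ := exists_unit_coneigenvector T hT W hW hTW
    rw [mem_W] at hx
    refine ⟨Fin.snoc v x, Fin.snoc d c, ⟨fun i => ?_, fun i j hij => ?_⟩, fun i => ?_⟩
    · refine Fin.lastCases ?_ (fun i => ?_) i
      · simpa using hx1
      · simpa using hv.1 i
    · induction i using Fin.lastCases with
      | last =>
        induction j using Fin.lastCases with
        | last => exact absurd rfl hij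
        | cast j => simpa using inner_eq_zero_symm.1 (hx j)
      | cast i =>
        induction j using Fin.lastCases with
        | last => simpa using hx i
        | cast j => simpa using hv.2 fun h => hij (congrArg Fin.castSucc h)
    · refine Fin.lastCases ?_ (fun i => ?_) i
      · simpa using ⟨hc, hTx⟩
      · simpa using hd i

/-- The conjugate-linear map `x ↦ A x̄` on Euclidean space. -/
noncomputable def Matrix.mulVecStar {n : Type*} [Fintype n] (A : Matrix n n ℂ) :
    EuclideanSpace ℂ n →ₗ⋆[ℂ] EuclideanSpace ℂ n where
  toFun x := WithLp.toLp 2 (A.mulVec (star x.ofLp))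
  map_add' x y := by simp [Matrix.mulVec_add]
  map_smul' c x := by simp [Matrix.mulVec_smul]

open scoped InnerProductSpace in
theorem Matrix.inner_mulVecStar {n : Type*} [Fintype n] (A : Matrix n n ℂ)
    (x y : EuclideanSpace ℂ n) :
    ⟪x, A.mulVecStar y⟫_ℂ = star x.ofLp ⬝ᵥ A.mulVec (star y.ofLp) := by
  rw [EuclideanSpace.inner_eq_star_dotProduct, dotProduct_comm]
  rfl

/-- **Autonne–Takagi factorization**: every complex symmetric matrix `A` can be written
as `Uᵀ D U⁻¹`-style, i.e. there is a unitary `U` with `U A Uᵀ` diagonal with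
nonnegative real diagonal entries. -/
theorem autonne_takagi
    (n : ℕ) (hn : 1 ≤ n) (A : Matrix (Fin n) (Fin n) ℂ) (hA : A.transpose = A) :
    ∃ U : Matrix (Fin n) (Fin n) ℂ, ∃ d : Fin n → ℝ,
      U ∈ Matrix.unitaryGroup (Fin n) ℂ ∧
      (∀ i, 0 ≤ d i) ∧
      U * A * U.transpose = Matrix.diagonal (fun i => (d i : ℂ)) := by
  obtain ⟨v, d, hv, hd⟩ := exists_orthonormal_coneigenvectors A.mulVecStar
    (fun x y => by
      rw [← inner_conj_symm, A.inner_mulVecStar, ← inner_conj_symm, A.inner_mulVecStar,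
        Matrix.dotProduct_mulVec, ← Matrix.mulVec_transpose, hA, dotProduct_comm])
    n (by simp)
  have hv' := orthonormal_iff_ite.1 hv
  refine ⟨Matrix.of fun i => star (v i).ofLp, d, ?_, fun i => (hd i).1, ?_⟩
  · rw [Matrix.mem_unitaryGroup_iff]
    ext i j
    rw [Matrix.one_apply, ← hv' i j, EuclideanSpace.inner_eq_star_dotProduct, dotProduct_comm]
    simp [Matrix.mul_apply, dotProduct, Matrix.star_apply]
  · ext i j
    have h := A.inner_mulVecStar (v i) (v j)
    rw [(hd j).2, inner_smul_right, hv'] at h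
    rw [Matrix.mul_assoc, Matrix.diagonal_apply]
    refine (h.symm.trans ?_ : star (v i).ofLp ⬝ᵥ A.mulVec (star (v j).ofLp) = _)
    split_ifs with hij <;> simp [hij]
end

section
/- Let N ≥ 1 and let u^δ and v^δ be the solutions of the semi-infinite and the finite discrete dynamical systems built from the same coefficient sequences a, b, both with control δ. Then u^δ(1,t) = v^δ(1,t) for all 0 ≤ t ≤ 2N-1 (equivalently, the response vectors satisfy r_t = r^N_t for t ≤ 2N-2, where r_t = u^δ(1,t+1) and r^N_t = v^δ(1,t+1)). -/
/-- Finite speed of propagation: the solution vanishes at site `n` before time `n`. -/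
theorem IsSol.eq_zero_of_lt {a b f : ℕ → ℂ} {u : ℕ → ℤ → ℂ} (hu : IsSol a b f u) {n : ℕ}
    (hn : 1 ≤ n) {t : ℤ} (ht : t < n) : u n t = 0 := by
  obtain ⟨hinit, -, -, hstep⟩ := hu
  have key : ∀ T : ℕ, ∀ n : ℕ, 1 ≤ n → ∀ t : ℤ, t ≤ T → t < n → u n t = 0 := by
    intro T
    induction T with
    | zero => exact fun n hn t ht _ => hinit n hn t (by simpa using ht)
    | succ T ih =>
      intro n hn t htT htn
      rcases (show t ≤ T ∨ t = (T : ℤ) + 1 by omega) with h | rfl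
      · exact ih n hn t h htn
      · have e := hstep n hn T
        rw [ih n hn (T - 1) (by omega) (by omega), ih (n + 1) (by omega) T le_rfl (by omega),
          ih (n - 1) (by omega) T le_rfl (by omega), ih n hn T le_rfl (by omega)] at e
        simpa using e
  exact key t.toNat n hn t (by omega) ht

/-- The semi-infinite and the finite systems with the same control agree until the wave
reflected at site `N + 1` arrives. -/
theorem IsSol.eq_of_isSolFin {a b f : ℕ → ℂ} {N : ℕ} {u v : ℕ → ℤ → ℂ}
    (hu : IsSol a b f u) (hv : IsSolFin a b N f v) {n : ℕ} (hn : n ≤ N + 1) {t : ℤ}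
    (ht : n + t ≤ 2 * N + 1) : u n t = v n t := by
  have hfront : ∀ t : ℤ, t < (N + 1 : ℕ) → u (N + 1) t = 0 := fun t ht =>
    hu.eq_zero_of_lt (Nat.succ_pos N) ht
  obtain ⟨hui, huc, hun, hus⟩ := hu
  obtain ⟨hvi, hvc, hvn, hvb, hvs⟩ := hv
  have hzero : ∀ t : ℤ, u 0 t = v 0 t := by
    intro t
    rcases lt_or_ge t 0 with h | h
    · rw [hun t h, hvn t h]
    · lift t to ℕ using h
      rw [huc, hvc]
  have key : ∀ T : ℕ, ∀ n : ℕ, n ≤ N + 1 → ∀ t : ℤ, t ≤ T → n + t ≤ 2 * N + 1 →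
      u n t = v n t := by
    intro T
    induction T with
    | zero =>
      intro n hn t ht _
      rcases Nat.eq_zero_or_pos n with rfl | h
      · exact hzero t
      · rw [hui n h t (by simpa using ht), hvi n h hn t (by simpa using ht)]
    | succ T ih =>
      intro n hn t htT htn
      rcases (show t ≤ T ∨ t = (T : ℤ) + 1 by omega) with h | rfl
      · exact ih n hn t h htn
      rcases Nat.eq_zero_or_pos n with rfl | hpos
      · exact hzero _
      rcases (show n = N + 1 ∨ n ≤ N by omega) with rfl | hN
      · rw [hvb, hfront _ (by omega)]
      · have e := hus n hpos T
        rw [ih n hn (T - 1) (by omega) (by omega), ih (n + 1) (by omega) T le_rfl (by omega),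
          ih (n - 1) (by omega) T le_rfl (by omega), ih n hn T le_rfl (by omega)] at e
        linear_combination e - hvs n hpos hN T
  exact key t.toNat n hn t (by omega) ht

/-- The responses of the semi-infinite and the finite systems (with the same
coefficients and control δ) agree up to time `2N - 1`. -/
theorem response_finite_infinite_agree
    (a b : ℕ → ℂ) (N : ℕ) (hN : 1 ≤ N)
    (u : ℕ → ℤ → ℂ) (hu : IsSol a b deltaCtrl u)
    (v : ℕ → ℤ → ℂ) (hv : IsSolFin a b N deltaCtrl v) :
    ∀ t : ℕ, t ≤ 2 * N - 1 → u 1 (t : ℤ) = v 1 (t : ℤ) := by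
  intro t ht
  exact hu.eq_of_isSolFin hv (by omega) (by omega)
end

section
/- Let N ≥ 1, B ≥ 0, and suppose |a_n| ≤ B for all n ≥ 0 and |b_n| ≤ B for all n ≥ 1. Let z ∈ ℂ with 0 < |z| < 1/(3B+1) and set λ = z + 1/z. Then for each 0 ≤ n ≤ N+1 the series v̂_n := -Σ_{t=0}^∞ z^t v^δ(n,t) converges absolutely; moreover v̂_0 = -1, v̂_{N+1} = 0, and a_{n-1}v̂_{n-1} + b_nv̂_n + a_nv̂_{n+1} = λ·v̂_n for all 1 ≤ n ≤ N. -/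
/-- The solution driven by the control `δ` grows at most like `(3B + 1) ^ t`. -/
theorem IsSolFin.norm_le_pow {a b : ℕ → ℂ} {N : ℕ} {B : ℝ} (hB : 0 ≤ B)
    (haB : ∀ n : ℕ, ‖a n‖ ≤ B) (hbB : ∀ n : ℕ, 1 ≤ n → ‖b n‖ ≤ B)
    {v : ℕ → ℤ → ℂ} (hv : IsSolFin a b N deltaCtrl v) (t : ℕ) :
    ∀ n : ℕ, n ≤ N + 1 →
      ‖v n (t : ℤ)‖ ≤ (3 * B + 1) ^ t ∧ ‖v n ((t : ℤ) - 1)‖ ≤ (3 * B + 1) ^ t := by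
  obtain ⟨hinit, hctrl, hneg, hend, hrec⟩ := hv
  have hM : 1 ≤ 3 * B + 1 := by linarith
  induction t with
  | zero =>
    intro n hn
    rcases Nat.eq_zero_or_pos n with rfl | hpos
    · have h0 := hctrl 0
      have h1 := hneg (-1) (by norm_num)
      simp_all [deltaCtrl]
    · have h0 := hinit n hpos hn 0 le_rfl
      have h1 := hinit n hpos hn (-1) (by norm_num)
      simp [h0, h1]
  | succ t ih =>
    intro n hn
    have hpow : 0 ≤ (3 * B + 1) ^ t := by positivity
    have hmono : (3 * B + 1) ^ t ≤ (3 * B + 1) ^ (t + 1) := pow_le_pow_right₀ hM t.le_succ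
    refine ⟨?_, ?_⟩
    · rcases Nat.eq_zero_or_pos n with rfl | hpos
      · rw [hctrl]
        simp only [deltaCtrl, Nat.succ_ne_zero, if_false, norm_zero]
        positivity
      · rcases Nat.lt_or_ge N n with hlt | hle
        · obtain rfl : n = N + 1 := by omega
          rw [hend, norm_zero]
          positivity
        · have hstep : v n ((t + 1 : ℕ) : ℤ) = a n * v (n + 1) t + a (n - 1) * v (n - 1) t
              + b n * v n t - v n ((t : ℤ) - 1) := by
            push_cast
            linear_combination hrec n hpos hle t
          have h1 : ‖a n * v (n + 1) t‖ ≤ B * (3 * B + 1) ^ t := by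
            rw [norm_mul]
            exact mul_le_mul (haB n) (ih (n + 1) (by omega)).1 (norm_nonneg _) hB
          have h2 : ‖a (n - 1) * v (n - 1) t‖ ≤ B * (3 * B + 1) ^ t := by
            rw [norm_mul]
            exact mul_le_mul (haB _) (ih (n - 1) (by omega)).1 (norm_nonneg _) hB
          have h3 : ‖b n * v n t‖ ≤ B * (3 * B + 1) ^ t := by
            rw [norm_mul]
            exact mul_le_mul (hbB n hpos) (ih n hn).1 (norm_nonneg _) hB
          have h4 := (ih n hn).2
          rw [hstep]
          calc _ ≤ B * (3 * B + 1) ^ t + B * (3 * B + 1) ^ t + B * (3 * B + 1) ^ t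
                + (3 * B + 1) ^ t :=
                norm_sub_le_of_le (norm_add_le_of_le (norm_add_le_of_le h1 h2) h3) h4
            _ = (3 * B + 1) ^ (t + 1) := by ring
    · have h : ((t + 1 : ℕ) : ℤ) - 1 = t := by push_cast; ring
      rw [h]
      exact (ih n hn).1.trans hmono

theorem fourier_transform_of_solution_finite
    (a b : ℕ → ℂ) (N : ℕ) (hN : 1 ≤ N) (B : ℝ) (hB : 0 ≤ B)
    (haB : ∀ n : ℕ, ‖a n‖ ≤ B) (hbB : ∀ n : ℕ, 1 ≤ n → ‖b n‖ ≤ B)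
    (v : ℕ → ℤ → ℂ) (hv : IsSolFin a b N deltaCtrl v)
    (z : ℂ) (hz0 : 0 < ‖z‖) (hz1 : ‖z‖ < 1 / (3 * B + 1))
    (lam : ℂ) (hlam : lam = z + 1 / z) :
    (∀ n : ℕ, n ≤ N + 1 → Summable (fun t : ℕ => ‖z ^ t * v n (t : ℤ)‖)) ∧
    (let vhat : ℕ → ℂ := fun n => -∑' t : ℕ, z ^ t * v n (t : ℤ)
     vhat 0 = -1 ∧ vhat (N + 1) = 0 ∧
     ∀ n : ℕ, 1 ≤ n → n ≤ N →
       a (n - 1) * vhat (n - 1) + b n * vhat n + a n * vhat (n + 1) = lam * vhat n) := by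
  have hsum : ∀ n : ℕ, n ≤ N + 1 → Summable (fun t : ℕ => ‖z ^ t * v n (t : ℤ)‖) := by
    intro n hn
    have hM : 0 < 3 * B + 1 := by linarith
    have hr : ‖z‖ * (3 * B + 1) < 1 := (lt_div_iff₀ hM).1 hz1
    refine Summable.of_nonneg_of_le (fun _ => norm_nonneg _) (fun t => ?_)
      (summable_geometric_of_lt_one (by positivity) hr)
    rw [norm_mul, norm_pow, mul_pow]
    exact mul_le_mul_of_nonneg_left (hv.norm_le_pow hB haB hbB t n hn).1 (by positivity)
  obtain ⟨hinit, hctrl, -, hend, hrec⟩ := hv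
  refine ⟨hsum, ?_, ?_, ?_⟩
  · simp [hctrl, deltaCtrl]
  · simp [hend]
  · intro n hpos hle
    have hz : z ≠ 0 := norm_pos_iff.1 hz0
    have hS : ∀ m : ℕ, m ≤ N + 1 →
        HasSum (fun t : ℕ => z ^ t * v m (t : ℤ)) (∑' t : ℕ, z ^ t * v m (t : ℤ)) :=
      fun m hm => (hsum m hm).of_norm.hasSum
    have hn := hS n (by omega)
    have hnext : HasSum (fun t : ℕ => z ^ t * v n ((t : ℤ) + 1))
        (z⁻¹ * ∑' t : ℕ, z ^ t * v n (t : ℤ)) := by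
      have h := ((hasSum_nat_add_iff' 1).2 hn).mul_left z⁻¹
      have h0 := hinit n hpos (by omega) 0 le_rfl
      simp only [Finset.range_one, Finset.sum_singleton, Nat.cast_zero, h0, mul_zero,
        sub_zero] at h
      refine h.congr_fun ?_
      intro t
      push_cast
      field_simp
      ring
    have hprev : HasSum (fun t : ℕ => z ^ t * v n ((t : ℤ) - 1))
        (z * ∑' t : ℕ, z ^ t * v n (t : ℤ)) := by
      have h0 := hinit n hpos (by omega) (-1) (by norm_num)
      refine (hasSum_nat_add_iff' 1).1 ?_
      simp only [Finset.range_one, Finset.sum_singleton, Nat.cast_zero, zero_sub, h0, mul_zero,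
        sub_zero]
      refine (hn.mul_left z).congr_fun ?_
      intro t
      push_cast
      rw [add_sub_cancel_right]
      ring
    have htotal := (((hnext.add hprev).sub ((hS (n + 1) (by omega)).mul_left (a n))).sub
      ((hS (n - 1) (by omega)).mul_left (a (n - 1)))).sub (hn.mul_left (b n))
    have hzero := htotal.unique (hasSum_zero.congr_fun fun t => by
      linear_combination z ^ t * hrec n hpos hle t)
    rw [hlam, one_div]
    linear_combination hzero
end
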